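/- arXiv:1810.09223 — 3 statements merged into one kernel-verified Lean document; each statement's English description precedes it below -/
import Mathlib

section
/- Let R > 0 and let Π be a measurable real-valued function on D = {(x,y) ∈ ℝ² : 0 ≤ x ≤ y}; set Π̄(x,λ) = Π(x, λx). Assume there exist constants ε₁,…,ε₆ with 1 ≥ ε₁ > ε₄ ≥ 0, 1 > ε₂ > ε₅ ≥ 0, ε₃ > ε₆ ≥ 0, constants λ₁ > 1 and 0 ≤ λ₂ < 1, a function ψ : (0,∞) → (0,∞) with ψ(T)/(log T)² → 0 as T → ∞, and a constant c > 0 such that: (1) for every λ > 1 and all a, b > R one has |∫_a^b Π̄(x,λ) dx| ≤ c·ψ(max(a,b))·(λ^{ε₄}/|λ−1|^{ε₁} + λ^{ε₅}/|λ−λ₁|^{ε₂} + λ^{ε₆}/|λ−λ₂|^{ε₃}); and (2) |Π(x,y)| ≤ c for all y > x > R. Then ∫∫_{{(x,y) : R ≤ x ≤ y}} |φ^{(R,T)}(x) − φ^{(R,T)}(y)|² · Π(x,y)/(y−x) dx dy → 0 as T → ∞. -/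
open MeasureTheory Filter

/-- The cutoff function `φ^{(R,T)}`: equal to `1` on `(-∞, R]`, to
`1 - log(x-R+1)/log(T-R+1)` on `[R, T]`, and to `0` on `[T, ∞)`. -/
noncomputable def phi (R T x : ℝ) : ℝ :=
  if x ≤ R then 1
  else if x ≤ T then 1 - Real.log (x - R + 1) / Real.log (T - R + 1)
  else 0


lemma aux_phi_eq {R T x : ℝ} (hx : R < x) (hT : R < T) :
    phi R T x = max 0 (1 - Real.log (x - R + 1) / Real.log (T - R + 1)) := by
  have hL : 0 < Real.log (T - R + 1) := Real.log_pos (by linarith)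
  unfold phi
  rw [if_neg (not_le.mpr hx)]
  split_ifs with h
  · rw [max_eq_right]
    rw [sub_nonneg, div_le_one hL]
    exact Real.log_le_log (by linarith) (by linarith)
  · rw [max_eq_left]
    rw [sub_nonpos, one_le_div hL]
    exact Real.log_le_log (by linarith) (by linarith)

lemma aux_phi_anti {R T x y : ℝ} (hx : R < x) (hxy : x ≤ y) (hT : R < T) :
    phi R T y ≤ phi R T x := by
  have hL : 0 < Real.log (T - R + 1) := Real.log_pos (by linarith)
  rw [aux_phi_eq hx hT, aux_phi_eq (hx.trans_le hxy) hT]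
  have : Real.log (x - R + 1) ≤ Real.log (y - R + 1) :=
    Real.log_le_log (by linarith) (by linarith)
  gcongr

lemma aux_phi_meas (R T : ℝ) : Measurable (phi R T) := by
  unfold phi
  refine Measurable.ite measurableSet_Iic measurable_const ?_
  refine Measurable.ite measurableSet_Iic ?_ measurable_const
  fun_prop

noncomputable def auxq (R T lam x : ℝ) : ℝ :=
  Real.log ((lam * x - R + 1) / (x - R + 1)) / Real.log (T - R + 1)

lemma aux_diff {R T x lam : ℝ} (hR : 0 < R) (hx : R < x) (hT : R < T) (hl : 1 < lam) :
    phi R T x - phi R T (lam * x) = min (phi R T x) (auxq R T lam x) := by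
  have hL : 0 < Real.log (T - R + 1) := Real.log_pos (by linarith)
  have hlx : x < lam * x := by nlinarith
  have hq : auxq R T lam x =
      Real.log (lam * x - R + 1) / Real.log (T - R + 1)
        - Real.log (x - R + 1) / Real.log (T - R + 1) := by
    unfold auxq
    rw [Real.log_div (by linarith) (by linarith), sub_div]
  have h3 : Real.log (x - R + 1) / Real.log (T - R + 1) ≤
      Real.log (lam * x - R + 1) / Real.log (T - R + 1) := by
    have := Real.log_le_log (x := x - R + 1) (y := lam * x - R + 1) (by linarith) (by linarith)
    gcongr
  rw [hq, aux_phi_eq hx hT, aux_phi_eq (hx.trans hlx) hT]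
  grind

lemma aux_ratio {R lam x : ℝ} (hx : R < x) :
    (lam * x - R + 1) / (x - R + 1) = lam + (lam - 1) * (R - 1) / (x - R + 1) := by
  have : x - R + 1 ≠ 0 := by linarith
  field_simp
  ring

lemma aux_q_quasi {R T lam x y z : ℝ} (hR : 0 < R) (hT : R < T) (hl : 1 < lam) (hx : R < x)
    (hxz : x ≤ z) (hzy : z ≤ y) :
    min (auxq R T lam x) (auxq R T lam y) ≤ auxq R T lam z := by
  have hL : 0 < Real.log (T - R + 1) := Real.log_pos (by linarith)
  have pos : ∀ u, R < u → 0 < (lam * u - R + 1) / (u - R + 1) := by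
    intro u hu
    have : 0 < lam * u - R + 1 := by nlinarith
    have : 0 < u - R + 1 := by linarith
    positivity
  have key : ∀ u v, R < u → R < v →
      (lam - 1) * (R - 1) / (u - R + 1) ≤ (lam - 1) * (R - 1) / (v - R + 1) →
      auxq R T lam u ≤ auxq R T lam v := by
    intro u v hu hv h
    unfold auxq
    have := Real.log_le_log (pos u hu) (y := (lam * v - R + 1) / (v - R + 1)) (by
      rw [aux_ratio hu, aux_ratio hv]; linarith)
    gcongr
  have hz : R < z := by linarith
  have hy : R < y := by linarith
  rcases le_total R 1 with h | h
  · refine (min_le_left _ _).trans (key _ _ hx hz ?_)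
    rw [div_le_div_iff₀ (by linarith) (by linarith)]
    have : (lam - 1) * (R - 1) ≤ 0 := by nlinarith
    nlinarith
  · refine (min_le_right _ _).trans (key _ _ hy hz ?_)
    rw [div_le_div_iff₀ (by linarith) (by linarith)]
    have : 0 ≤ (lam - 1) * (R - 1) := mul_nonneg (by linarith) (by linarith)
    nlinarith

lemma aux_q_le {R T lam x : ℝ} (hR : 0 < R) (hT : R < T) (hl : 1 < lam) (hx : R < x) :
    auxq R T lam x ≤ Real.log (1 + (1 + R) * (lam - 1)) / Real.log (T - R + 1) := by
  have hL : 0 < Real.log (T - R + 1) := Real.log_pos (by linarith)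
  unfold auxq
  have h0 : 0 < x - R + 1 := by linarith
  have h1 : 0 < lam * x - R + 1 := by nlinarith
  have := Real.log_le_log (x := (lam * x - R + 1) / (x - R + 1))
    (y := 1 + (1 + R) * (lam - 1)) (by positivity) (by
      rw [div_le_iff₀ h0]
      have : 0 ≤ (lam - 1) * ((1 + R) * (x - R + 1) - x) :=
        mul_nonneg (by linarith) (by nlinarith)
      nlinarith)
  gcongr

lemma aux_q_nonneg {R T lam x : ℝ} (hR : 0 < R) (hT : R < T) (hl : 1 < lam) (hx : R < x) :
    0 ≤ auxq R T lam x := by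
  have hL : 0 < Real.log (T - R + 1) := Real.log_pos (by linarith)
  unfold auxq
  refine div_nonneg (Real.log_nonneg ?_) hL.le
  rw [le_div_iff₀ (by linarith)]
  nlinarith

/-- the weight -/
noncomputable def auxg (R T lam x : ℝ) : ℝ := |phi R T x - phi R T (lam * x)| ^ 2

lemma aux_g_eq {R T x lam : ℝ} (hR : 0 < R) (hx : R < x) (hT : R < T) (hl : 1 < lam) :
    auxg R T lam x = (min (phi R T x) (auxq R T lam x)) ^ 2 := by
  unfold auxg
  rw [aux_diff hR hx hT hl, sq_abs]

lemma aux_min_nonneg {R T x lam : ℝ} (hR : 0 < R) (hx : R < x) (hT : R < T) (hl : 1 < lam) :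
    0 ≤ min (phi R T x) (auxq R T lam x) := by
  refine le_min ?_ (aux_q_nonneg hR hT hl hx)
  rw [aux_phi_eq hx hT]
  exact le_max_left _ _

lemma aux_g_le {R T x lam : ℝ} (hR : 0 < R) (hx : R < x) (hT : R < T) (hl : 1 < lam) :
    auxg R T lam x ≤ (Real.log (1 + (1 + R) * (lam - 1)) / Real.log (T - R + 1)) ^ 2 := by
  rw [aux_g_eq hR hx hT hl]
  exact pow_le_pow_left₀ (aux_min_nonneg hR hx hT hl)
    ((min_le_right _ _).trans (aux_q_le hR hT hl hx)) 2

lemma aux_g_zero {R T x lam : ℝ} (hR : 0 < R) (hx : T < x) (hT : R < T) (hl : 1 < lam) :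
    auxg R T lam x = 0 := by
  have hlx : x < lam * x := by nlinarith
  unfold auxg phi
  rw [if_neg (by linarith), if_neg (by linarith), if_neg (by linarith), if_neg (by linarith)]
  simp

lemma aux_g_quasi {R T lam x y z : ℝ} (hR : 0 < R) (hT : R < T) (hl : 1 < lam) (hx : R < x)
    (hxz : x ≤ z) (hzy : z ≤ y) :
    min (auxg R T lam x) (auxg R T lam y) ≤ auxg R T lam z := by
  have hz : R < z := by linarith
  have hy : R < y := by linarith
  rw [aux_g_eq hR hx hT hl, aux_g_eq hR hy hT hl, aux_g_eq hR hz hT hl]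
  have h1 := aux_phi_anti (T := T) hz hzy hT
  have h2 := aux_q_quasi hR hT hl hx hxz hzy
  have h3 : min (min (phi R T x) (auxq R T lam x)) (min (phi R T y) (auxq R T lam y)) ≤
      min (phi R T z) (auxq R T lam z) := by grind
  rcases min_le_iff.mp h3 with h | h
  · exact (min_le_left _ _).trans (pow_le_pow_left₀ (aux_min_nonneg hR hx hT hl) h 2)
  · exact (min_le_right _ _).trans (pow_le_pow_left₀ (aux_min_nonneg hR hy hT hl) h 2)

lemma aux_ordconn {R T B : ℝ} {f : ℝ → ℝ} (hB : 0 ≤ B)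
    (hF : ∀ a b, R ≤ a → a ≤ b → b ≤ T → |∫ x in a..b, f x| ≤ B)
    {S : Set ℝ} (hS : S ⊆ Set.Ioc R T) (hc : S.OrdConnected) :
    |∫ x in S, f x| ≤ B := by
  rcases S.eq_empty_or_nonempty with h | h
  · simp [h, hB]
  have hbb : BddBelow S := bddBelow_Ioc.mono hS
  have hba : BddAbove S := bddAbove_Ioc.mono hS
  have h1 : Set.Ioo (sInf S) (sSup S) ⊆ S := by
    intro z hz
    obtain ⟨x, hx, hxz⟩ := exists_lt_of_csInf_lt h hz.1
    obtain ⟨y, hy, hzy⟩ := exists_lt_of_lt_csSup h hz.2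
    exact hc.out hx hy ⟨hxz.le, hzy.le⟩
  have h2 : S ⊆ Set.Icc (sInf S) (sSup S) := fun z hz => ⟨csInf_le hbb hz, le_csSup hba hz⟩
  have h3 : sInf S ≤ sSup S := csInf_le_csSup h hbb hba
  have h4 : S =ᵐ[volume] Set.Ioc (sInf S) (sSup S) := by
    refine Filter.EventuallyLE.antisymm ?_ ?_
    · exact (LE.le.eventuallyLE h2).trans Ioc_ae_eq_Icc.symm.le
    · exact Ioo_ae_eq_Ioc.symm.le.trans (LE.le.eventuallyLE h1)
  rw [setIntegral_congr_set h4, ← intervalIntegral.integral_of_le h3]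
  exact hF _ _ (le_csInf h fun x hx => (hS hx).1.le) h3 (csSup_le h fun x hx => (hS hx).2)

lemma aux_layer {R T B M : ℝ} {f g : ℝ → ℝ} (hB : 0 ≤ B) (hM : 0 ≤ M)
    (hF : ∀ a b, R ≤ a → a ≤ b → b ≤ T → |∫ x in a..b, f x| ≤ B)
    (hf : IntegrableOn f (Set.Ioc R T)) (hg : Measurable g)
    (hg0 : ∀ x, 0 ≤ g x) (hgM : ∀ x, R < x → g x ≤ M)
    (hq : ∀ x y z, R < x → x ≤ z → z ≤ y → min (g x) (g y) ≤ g z) :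
    |∫ x in Set.Ioc R T, g x * f x| ≤ B * M := by
  have e1 : ∫ x in Set.Ioc R T, g x * f x =
      ∫ x in Set.Ioc R T, ∫ t in Set.Ioc 0 M, if t < g x then f x else 0 := by
    refine setIntegral_congr_fun measurableSet_Ioc fun x hx => ?_
    have : (fun t => if t < g x then f x else 0) =
        (Set.Iio (g x)).indicator (fun _ => f x) := by
      ext t; simp [Set.indicator]
    simp only [this]
    rw [setIntegral_indicator measurableSet_Iio, setIntegral_const]
    have : Set.Ioc 0 M ∩ Set.Iio (g x) = Set.Ioo 0 (g x) := by
      ext t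
      have := hgM x hx.1
      simp only [Set.mem_inter_iff, Set.mem_Ioc, Set.mem_Iio, Set.mem_Ioo]
      constructor
      · rintro ⟨⟨a, b⟩, c⟩; exact ⟨a, c⟩
      · rintro ⟨a, b⟩; exact ⟨⟨a, by linarith⟩, b⟩
    rw [this]
    simp [hg0 x]
  have hms : MeasurableSet {p : ℝ × ℝ | p.2 < g p.1} :=
    measurableSet_lt measurable_snd (hg.comp measurable_fst)
  have hI : Integrable (Function.uncurry fun x t : ℝ => if t < g x then f x else 0)
      ((volume.restrict (Set.Ioc R T)).prod (volume.restrict (Set.Ioc 0 M))) := by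
    have h0 : Integrable (fun p : ℝ × ℝ => f p.1)
      ((volume.restrict (Set.Ioc R T)).prod (volume.restrict (Set.Ioc 0 M))) :=
      Integrable.comp_fst hf _
    have := h0.indicator hms
    refine this.congr (Filter.Eventually.of_forall fun p => ?_)
    simp [Set.indicator, Function.uncurry]
  rw [e1, integral_integral_swap hI, ← Real.norm_eq_abs]
  have := norm_setIntegral_le_of_norm_le_const (μ := volume) (s := Set.Ioc 0 M) (C := B)
    (f := fun t => ∫ x in Set.Ioc R T, if t < g x then f x else 0) (by simp) (by
      intro t ht
      have e : (fun x => if t < g x then f x else 0) = {x | t < g x}.indicator f := by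
        ext x; simp [Set.indicator]
      rw [e, setIntegral_indicator (measurableSet_lt measurable_const hg), Real.norm_eq_abs]
      refine aux_ordconn hB hF Set.inter_subset_left ⟨?_⟩
      rintro x ⟨hx, hx'⟩ y ⟨hy, hy'⟩ z ⟨hxz, hzy⟩
      refine ⟨⟨by linarith [hx.1], by linarith [hy.2]⟩, ?_⟩
      exact (lt_min hx' hy').trans_le (hq x y z hx.1 hxz hzy))
  simpa [hM] using this

lemma aux_cv {R : ℝ} (hR : 0 < R) {G : ℝ × ℝ → ℝ} (hG : Measurable G)
    (hI : IntegrableOn G {p : ℝ × ℝ | R ≤ p.1 ∧ p.1 ≤ p.2}) :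
    ∫ p in {p : ℝ × ℝ | R ≤ p.1 ∧ p.1 ≤ p.2}, G p =
      ∫ lam in Set.Ioi (1 : ℝ), ∫ x in Set.Ioi R, x * G (x, lam * x) := by
  set D : Set (ℝ × ℝ) := {p : ℝ × ℝ | R ≤ p.1 ∧ p.1 ≤ p.2} with hD
  have hDm : MeasurableSet D :=
    (measurableSet_le measurable_const measurable_fst).inter
      (measurableSet_le measurable_fst measurable_snd)
  have hI' : Integrable (D.indicator G) ((volume : Measure ℝ).prod volume) := by
    rw [← Measure.volume_eq_prod]; exact (integrable_indicator_iff hDm).mpr hI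
  have sl : ∀ x, R < x → (fun y => D.indicator G (x, y)) =
      (Set.Ici x).indicator (fun y => G (x, y)) := by
    intro x hx
    ext y
    by_cases h : x ≤ y <;> simp [hD, Set.indicator, hx.le, h]
  have sl0 : ∀ x, x < R → (fun y => D.indicator G (x, y)) = fun _ => 0 := by
    intro x hx
    ext y
    simp [hD, Set.indicator, not_le.mpr hx]
  have cvi : ∀ x, R < x → ∀ g : ℝ → ℝ, ∫ lam in Set.Ioi (1 : ℝ), x * g (lam * x) =
      ∫ y in Set.Ici x, g y := by
    intro x hx g
    have hx0 : 0 < x := hR.trans hx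
    rw [integral_const_mul, integral_comp_mul_right_Ioi g 1 hx0, integral_Ici_eq_integral_Ioi]
    simp only [one_mul, smul_eq_mul]
    field_simp
  have hHm : Measurable (fun p : ℝ × ℝ => p.1 * G (p.1, p.2 * p.1)) := by fun_prop
  have hH : Integrable (Function.uncurry fun x lam : ℝ => x * G (x, lam * x))
      ((volume.restrict (Set.Ioi R)).prod (volume.restrict (Set.Ioi 1))) := by
    refine (integrable_prod_iff (hHm.aestronglyMeasurable)).mpr ⟨?_, ?_⟩
    · filter_upwards [ae_restrict_of_ae hI'.prod_right_ae, ae_restrict_mem measurableSet_Ioi]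
        with x hx hxR
      rw [sl x hxR, integrable_indicator_iff measurableSet_Ici] at hx
      have h2 : IntegrableOn (fun y => G (x, y)) (Set.Ioi (1 * x)) := by
        rw [one_mul]; exact hx.mono_set Set.Ioi_subset_Ici_self
      have h3 := (integrableOn_Ioi_comp_mul_right_iff (fun y => G (x, y)) 1
        (hR.trans hxR)).mpr h2
      exact Integrable.const_mul h3 x
    · have := hI'.integral_norm_prod_left
      refine (this.restrict (s := Set.Ioi R)).congr ?_
      filter_upwards [ae_restrict_mem measurableSet_Ioi] with x hxR
      have e : (fun y => ‖D.indicator G (x, y)‖) =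
          (Set.Ici x).indicator (fun y => ‖G (x, y)‖) := by
        ext y
        have := congrFun (sl x hxR) y
        rw [this, Set.indicator_apply, Set.indicator_apply]
        split_ifs <;> simp
      rw [e, integral_indicator measurableSet_Ici, ← cvi x hxR (fun y => ‖G (x, y)‖)]
      refine integral_congr_ae (Filter.Eventually.of_forall fun lam => ?_)
      have hx0 : 0 < x := hR.trans hxR
      simp [abs_of_pos hx0]
  have e1 : ∫ p in D, G p = ∫ x, ∫ y, D.indicator G (x, y) := by
    rw [← integral_indicator hDm, Measure.volume_eq_prod, integral_prod _ hI']
  have e2 : ∫ x, ∫ y, D.indicator G (x, y) =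
      ∫ x in Set.Ioi R, ∫ y, D.indicator G (x, y) := by
    rw [← integral_Ici_eq_integral_Ioi, setIntegral_eq_integral_of_forall_compl_eq_zero]
    intro x hx
    rw [sl0 x (by simpa using hx)]
    simp
  rw [e1, e2, ← integral_integral_swap hH]
  refine setIntegral_congr_fun measurableSet_Ioi fun x hx => ?_
  have : ∫ y, D.indicator G (x, y) = ∫ y in Set.Ici x, G (x, y) := by
    rw [sl x hx, integral_indicator measurableSet_Ici]
  simp only [this]
  rw [cvi x hx (fun y => G (x, y))]

/-- the auxiliary factor -/
noncomputable def auxw (A lam : ℝ) : ℝ := Real.log (1 + A * (lam - 1)) ^ 2 / (lam - 1)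

lemma aux_w_nonneg {A lam : ℝ} (hl : 1 < lam) : 0 ≤ auxw A lam :=
  div_nonneg (sq_nonneg _) (by linarith)

lemma aux_w_le {A lam : ℝ} (hA : 1 ≤ A) (hl : 1 < lam) : auxw A lam ≤ A ^ 2 * (lam - 1) := by
  unfold auxw
  have h0 : 0 < lam - 1 := by linarith
  have h1 : 0 ≤ A * (lam - 1) := by positivity
  rw [div_le_iff₀ h0]
  have h2 : Real.log (1 + A * (lam - 1)) ≤ A * (lam - 1) := by
    have := Real.log_le_sub_one_of_pos (x := 1 + A * (lam - 1)) (by linarith)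
    linarith
  have h3 : 0 ≤ Real.log (1 + A * (lam - 1)) := Real.log_nonneg (by linarith)
  calc _ ≤ (A * (lam - 1)) ^ 2 := pow_le_pow_left₀ h3 h2 2
    _ = _ := by ring

lemma aux_term_meas (A m e e' : ℝ) :
    Measurable (fun lam : ℝ => lam ^ e' / |lam - m| ^ e * auxw A lam) := by
  unfold auxw
  fun_prop

lemma aux_tail {A m e e' l : ℝ} (hA : 1 ≤ A) (hl : 1 < l) (hm : m ≤ l) (he' : 0 ≤ e')
    (he : e' < e) :
    IntegrableOn (fun lam : ℝ => lam ^ e' / |lam - m| ^ e * auxw A lam) (Set.Ioi (l + 1)) := by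
  set η := (e - e') / 4 with hη
  have hη0 : 0 < η := by rw [hη]; linarith
  have hint : IntegrableOn (fun lam : ℝ =>
      ((l + 1) ^ e * (A ^ η / η) ^ 2 * (l + 1)) * lam ^ (-1 - 2 * η)) (Set.Ioi (l + 1)) :=
    (integrableOn_Ioi_rpow_of_lt (by linarith) (by linarith)).const_mul _
  refine Integrable.mono' hint (aux_term_meas A m e e').aestronglyMeasurable ?_
  filter_upwards [ae_restrict_mem measurableSet_Ioi] with lam hlam
  have hlam : l + 1 < lam := hlam
  have hl0 : 0 < lam := by linarith
  have hk : ∀ u, u ≤ l → lam / (l + 1) ≤ lam - u := by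
    intro u hu
    rw [div_le_iff₀ (by linarith)]
    nlinarith
  have hpos : 0 < lam / (l + 1) := by positivity
  have hw := aux_w_nonneg (A := A) (lam := lam) (by linarith)
  rw [Real.norm_eq_abs, abs_of_nonneg (by positivity)]
  have h1 : lam ^ e' / |lam - m| ^ e ≤ (l + 1) ^ e * lam ^ (e' - e) := by
    have : (lam / (l + 1)) ^ e ≤ |lam - m| ^ e :=
      Real.rpow_le_rpow hpos.le ((hk m hm).trans (le_abs_self _)) (by linarith)
    calc lam ^ e' / |lam - m| ^ e ≤ lam ^ e' / (lam / (l + 1)) ^ e := by gcongr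
      _ = _ := by
        rw [Real.div_rpow hl0.le (by linarith), Real.rpow_sub hl0]
        field_simp
  have h2 : auxw A lam ≤ (A ^ η / η) ^ 2 * (l + 1) * lam ^ (2 * η - 1) := by
    unfold auxw
    have a1 : Real.log (1 + A * (lam - 1)) ≤ (A ^ η / η) * lam ^ η := by
      have b1 : Real.log (1 + A * (lam - 1)) ≤ Real.log (A * lam) :=
        Real.log_le_log (by nlinarith) (by nlinarith)
      have b2 := Real.log_le_rpow_div (x := A * lam) (by positivity) hη0
      rw [Real.mul_rpow (by linarith) hl0.le] at b2
      calc _ ≤ _ := b1.trans b2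
        _ = _ := by ring
    have a2 : 0 ≤ Real.log (1 + A * (lam - 1)) := Real.log_nonneg (by nlinarith)
    calc _ ≤ ((A ^ η / η) * lam ^ η) ^ 2 / (lam / (l + 1)) := by
          gcongr
          exact hk 1 hl.le
      _ = _ := by
        rw [Real.rpow_sub hl0, two_mul, Real.rpow_add hl0, Real.rpow_one]
        field_simp
  calc _ ≤ ((l + 1) ^ e * lam ^ (e' - e)) * ((A ^ η / η) ^ 2 * (l + 1) * lam ^ (2 * η - 1)) := by
        gcongr
    _ = ((l + 1) ^ e * (A ^ η / η) ^ 2 * (l + 1)) * (lam ^ (e' - e) * lam ^ (2 * η - 1)) := by ring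
    _ = _ := by
      rw [← Real.rpow_add hl0]
      congr 2
      rw [hη]; ring

lemma aux_near1 {A e e' l : ℝ} (hA : 1 ≤ A) (hl : 1 < l) (he' : 0 ≤ e') (he1 : e ≤ 1) :
    IntegrableOn (fun lam : ℝ => lam ^ e' / |lam - 1| ^ e * auxw A lam) (Set.Ioc 1 (l + 1)) := by
  refine Measure.integrableOn_of_bounded (M := (l + 1) ^ e' * (A ^ 2 * l ^ (1 - e))) (by simp)
    (aux_term_meas A 1 e e').aestronglyMeasurable ?_
  filter_upwards [ae_restrict_mem measurableSet_Ioc] with lam hlam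
  obtain ⟨h1, h2⟩ := hlam
  have h0 : 0 < lam - 1 := by linarith
  have hw := aux_w_nonneg (A := A) h1
  rw [Real.norm_eq_abs, abs_of_nonneg (by positivity), abs_of_pos h0]
  calc _ ≤ (l + 1) ^ e' / (lam - 1) ^ e * (A ^ 2 * (lam - 1)) := by
        gcongr
        exact aux_w_le hA h1
    _ = (l + 1) ^ e' * (A ^ 2 * (lam - 1) ^ (1 - e)) := by
        rw [Real.rpow_sub h0, Real.rpow_one]; ring
    _ ≤ _ := by
        have : (lam - 1) ^ (1 - e) ≤ l ^ (1 - e) :=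
          Real.rpow_le_rpow h0.le (by linarith) (by linarith)
        gcongr

lemma aux_near3 {A m e e' l : ℝ} (hA : 1 ≤ A) (hl : 1 < l) (hm : m < 1) (he' : 0 ≤ e')
    (he0 : 0 ≤ e) :
    IntegrableOn (fun lam : ℝ => lam ^ e' / |lam - m| ^ e * auxw A lam) (Set.Ioc 1 (l + 1)) := by
  refine Measure.integrableOn_of_bounded (M := (l + 1) ^ e' / (1 - m) ^ e * (A ^ 2 * l)) (by simp)
    (aux_term_meas A m e e').aestronglyMeasurable ?_
  filter_upwards [ae_restrict_mem measurableSet_Ioc] with lam hlam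
  obtain ⟨h1, h2⟩ := hlam
  have h0 : 0 < lam - 1 := by linarith
  have hm0 : 0 < 1 - m := by linarith
  have hw := aux_w_nonneg (A := A) h1
  rw [Real.norm_eq_abs, abs_of_nonneg (by positivity), abs_of_pos (by linarith : 0 < lam - m)]
  have h3 := aux_w_le hA h1
  have h4 : auxw A lam ≤ A ^ 2 * l := h3.trans (by gcongr; linarith)
  gcongr

lemma aux_near2 {A e e' l : ℝ} (hA : 1 ≤ A) (hl : 1 < l) (he' : 0 ≤ e') (he1 : e < 1) :
    IntegrableOn (fun lam : ℝ => lam ^ e' / |lam - l| ^ e * auxw A lam) (Set.Ioc 1 (l + 1)) := by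
  have hI : IntegrableOn (fun lam : ℝ => |lam - l| ^ (-e)) (Set.Ioc 1 (l + 1)) := by
    have i1 : IntegrableOn (fun lam : ℝ => |lam - l| ^ (-e)) (Set.Ioc 1 l) := by
      have := (intervalIntegral.intervalIntegrable_rpow' (a := l - 1) (b := 0) (r := -e)
        (by linarith)).comp_sub_left l
      rw [show l - (l - 1) = 1 by ring, sub_zero,
        intervalIntegrable_iff_integrableOn_Ioc_of_le hl.le] at this
      refine this.congr_fun (fun x hx => ?_) measurableSet_Ioc
      simp only
      rw [abs_of_nonpos (by linarith [hx.2]), neg_sub]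
    have i2 : IntegrableOn (fun lam : ℝ => |lam - l| ^ (-e)) (Set.Ioc l (l + 1)) := by
      have := (intervalIntegral.intervalIntegrable_rpow' (a := 0) (b := 1) (r := -e)
        (by linarith)).comp_sub_right l
      rw [zero_add, add_comm, intervalIntegrable_iff_integrableOn_Ioc_of_le (by linarith)] at this
      refine this.congr_fun (fun x hx => ?_) measurableSet_Ioc
      simp only
      rw [abs_of_nonneg (by linarith [hx.1])]
    have := i1.union i2
    rwa [Set.Ioc_union_Ioc_eq_Ioc hl.le (by linarith)] at this
  refine Integrable.mono' (hI.const_mul ((l + 1) ^ e' * (A ^ 2 * l)))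
    (aux_term_meas A l e e').aestronglyMeasurable ?_
  filter_upwards [ae_restrict_mem measurableSet_Ioc] with lam hlam
  obtain ⟨h1, h2⟩ := hlam
  have h0 : 0 < lam - 1 := by linarith
  have hw := aux_w_nonneg (A := A) h1
  rw [Real.norm_eq_abs, abs_of_nonneg (by positivity)]
  have h3 := aux_w_le hA h1
  have h4 : auxw A lam ≤ A ^ 2 * l := h3.trans (by gcongr; linarith)
  calc _ ≤ (l + 1) ^ e' / |lam - l| ^ e * (A ^ 2 * l) := by gcongr
    _ = _ := by rw [Real.rpow_neg (abs_nonneg _)]; ring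

lemma aux_W {A ε₁ ε₂ ε₃ ε₄ ε₅ ε₆ lam₁ lam₂ : ℝ} (hA : 1 ≤ A)
    (hε₁ : ε₁ ≤ 1) (hε₁₄ : ε₄ < ε₁) (hε₄ : 0 ≤ ε₄)
    (hε₂ : ε₂ < 1) (hε₂₅ : ε₅ < ε₂) (hε₅ : 0 ≤ ε₅)
    (hε₃₆ : ε₆ < ε₃) (hε₆ : 0 ≤ ε₆)
    (hlam₁ : 1 < lam₁) (hlam₂ : lam₂ < 1) :
    IntegrableOn (fun lam : ℝ => (lam ^ ε₄ / |lam - 1| ^ ε₁ + lam ^ ε₅ / |lam - lam₁| ^ ε₂ +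
            lam ^ ε₆ / |lam - lam₂| ^ ε₃) * auxw A lam) (Set.Ioi 1) := by
  have u : Set.Ioi (1 : ℝ) = Set.Ioc 1 (lam₁ + 1) ∪ Set.Ioi (lam₁ + 1) :=
    (Set.Ioc_union_Ioi_eq_Ioi (by linarith)).symm
  have t1 := (aux_near1 hA hlam₁ hε₄ hε₁).union (aux_tail hA hlam₁ hlam₁.le hε₄ hε₁₄)
  have t2 := (aux_near2 hA hlam₁ hε₅ hε₂).union (aux_tail hA hlam₁ le_rfl hε₅ hε₂₅)
  have t3 := (aux_near3 hA hlam₁ hlam₂ hε₆ (by linarith : 0 ≤ ε₃)).union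
    (aux_tail hA hlam₁ (by linarith : lam₂ ≤ lam₁) hε₆ hε₃₆)
  rw [← u] at t1 t2 t3
  refine ((t1.add t2).add t3).congr_fun (fun x _ => ?_) measurableSet_Ioi
  simp only [Pi.add_apply]
  ring

lemma aux_int {R c lam : ℝ} (hR : 0 < R) {P : ℝ → ℝ → ℝ}
    (hmeas : Measurable fun p : ℝ × ℝ => P p.1 p.2)
    (hbd : ∀ x y : ℝ, R < x → x < y → |P x y| ≤ c) (hl : 1 < lam) (b : ℝ) :
    IntegrableOn (fun x => P x (lam * x)) (Set.Ioc R b) := by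
  have hm : Measurable (fun x => P x (lam * x)) :=
    hmeas.comp (f := fun x : ℝ => (x, lam * x)) (by fun_prop)
  refine Measure.integrableOn_of_bounded (M := c) (by simp) hm.aestronglyMeasurable ?_
  filter_upwards [ae_restrict_mem measurableSet_Ioc] with x hx
  have h := hx.1
  exact hbd x _ h (by nlinarith)

lemma aux_unif {R c : ℝ} (hR : 0 < R) (hc : 0 < c) {P : ℝ → ℝ → ℝ}
    (hmeas : Measurable fun p : ℝ × ℝ => P p.1 p.2)
    (hbd : ∀ x y : ℝ, R < x → x < y → |P x y| ≤ c)
    {ψ K : ℝ → ℝ} (hK : ∀ lam, 1 < lam → 0 ≤ K lam)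
    (hψ : Tendsto (fun T : ℝ => ψ T / (Real.log T) ^ 2) atTop (nhds 0))
    (hint : ∀ lam a b : ℝ, 1 < lam → R < a → R < b →
      |∫ x in a..b, P x (lam * x)| ≤ c * ψ (max a b) * K lam)
    {δ : ℝ} (hδ : 0 < δ) :
    ∃ T0, R < T0 ∧ ∀ T, T0 ≤ T → ∀ lam, 1 < lam → ∀ a b, R ≤ a → a ≤ b → b ≤ T →
      |∫ x in a..b, P x (lam * x)| ≤ δ * Real.log (T - R + 1) ^ 2 * K lam := by
  have hδ' : 0 < δ / (8 * c) := by positivity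
  obtain ⟨X1, hX1⟩ := Filter.eventually_atTop.mp (hψ.eventually_lt_const hδ')
  set X0 := max X1 (max 2 (2 * R)) with hX0
  have hX1' : X1 ≤ X0 := le_max_left _ _
  have hX2 : 2 ≤ X0 := (le_max_left _ _).trans (le_max_right _ _)
  have hX3 : 2 * R ≤ X0 := (le_max_right _ _).trans (le_max_right _ _)
  have hψ' : ∀ x, X0 ≤ x → ψ x ≤ δ / (8 * c) * Real.log x ^ 2 := by
    intro x hx
    have hlog : 0 < Real.log x := Real.log_pos (by linarith)
    have := hX1 x (hX1'.trans hx)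
    rw [div_lt_iff₀ (by positivity)] at this
    exact this.le
  refine ⟨X0, by linarith, fun T hT lam hl => ?_⟩
  have hKl := hK lam hl
  have hii : ∀ a b, R ≤ a → R ≤ b → IntervalIntegrable (fun x => P x (lam * x)) volume a b := by
    intro a b ha hb
    rw [intervalIntegrable_iff]
    exact (aux_int hR hmeas hbd hl (max a b)).mono_set
      (Set.Ioc_subset_Ioc_left (le_min ha hb))
  have hlogT : ∀ x, X0 ≤ x → x ≤ T → c * ψ x ≤ δ / 2 * Real.log (T - R + 1) ^ 2 := by
    intro x hx hxT
    have h1 : Real.log x ≤ 2 * Real.log (T - R + 1) := by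
      have : Real.log ((T - R + 1) ^ 2) = 2 * Real.log (T - R + 1) := by
        rw [Real.log_pow]; norm_num
      rw [← this]
      exact Real.log_le_log (by linarith) (by nlinarith)
    have h2 : 0 ≤ Real.log x := Real.log_nonneg (by linarith)
    have h3 : Real.log x ^ 2 ≤ (2 * Real.log (T - R + 1)) ^ 2 := pow_le_pow_left₀ h2 h1 2
    calc c * ψ x ≤ c * (δ / (8 * c) * (2 * Real.log (T - R + 1)) ^ 2) := by
          have := hψ' x hx
          gcongr
          exact this.trans (by gcongr)
      _ = _ := by field_simp; ring
  have hpos : ∀ a b, R < a → a ≤ b → b ≤ T →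
      |∫ x in a..b, P x (lam * x)| ≤ δ * Real.log (T - R + 1) ^ 2 * K lam := by
    intro a b ha hab hb
    have hL : 0 ≤ δ * Real.log (T - R + 1) ^ 2 * K lam := by positivity
    rcases le_total X0 b with h | h
    · have h1 := hint lam a b hl ha (by linarith)
      rw [max_eq_right hab] at h1
      have h2 := mul_le_mul_of_nonneg_right (hlogT b h hb) hKl
      linarith
    · have h1 := hint lam a X0 hl ha (by linarith)
      have h2 := hint lam b X0 hl (by linarith) (by linarith)
      rw [max_eq_right (hab.trans h)] at h1
      rw [max_eq_right h] at h2
      have h3 := mul_le_mul_of_nonneg_right (hlogT X0 le_rfl hT) hKl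
      have h4 := intervalIntegral.integral_add_adjacent_intervals
        (hii a b ha.le (by linarith)) (hii b X0 (by linarith) (by linarith))
      rw [eq_sub_of_add_eq h4]
      have := abs_sub (∫ x in a..X0, P x (lam * x)) (∫ x in b..X0, P x (lam * x))
      linarith
  intro a b ha hab hb
  rcases ha.lt_or_eq with h | h
  · exact hpos a b h hab hb
  subst h
  rcases hab.lt_or_eq with h' | h'
  swap
  · subst h'
    simp only [intervalIntegral.integral_same, abs_zero]
    positivity
  refine le_of_forall_pos_le_add fun η hη => ?_
  set a := min b (R + η / c) with hadef
  have ha1 : R < a := lt_min h' (by have : 0 < η / c := by positivity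
                                    linarith)
  have h1 := hpos a b ha1 (min_le_left _ _) hb
  have h2 : |∫ x in R..a, P x (lam * x)| ≤ η := by
    rw [← Real.norm_eq_abs]
    have := intervalIntegral.norm_integral_le_of_norm_le_const (a := R) (b := a) (C := c)
      (f := fun x => P x (lam * x)) (by
        intro x hx
        rw [Set.uIoc_of_le ha1.le] at hx
        have h := hx.1
        exact hbd x _ h (by nlinarith))
    refine this.trans ?_
    rw [abs_of_pos (by linarith)]
    have : a ≤ R + η / c := min_le_right _ _
    calc c * (a - R) ≤ c * (η / c) := by gcongr; linarith
      _ = η := by field_simp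
  have h3 := intervalIntegral.integral_add_adjacent_intervals
    (hii R a le_rfl ha1.le) (hii a b ha1.le hab)
  rw [← h3]
  have := abs_add_le (∫ x in R..a, P x (lam * x)) (∫ x in a..b, P x (lam * x))
  linarith

theorem stmt_2 (R : ℝ) (hR : 0 < R) (Pi : ℝ → ℝ → ℝ)
    (hmeas : Measurable fun p : ℝ × ℝ => Pi p.1 p.2)
    (ε₁ ε₂ ε₃ ε₄ ε₅ ε₆ : ℝ)
    (hε₁ : ε₁ ≤ 1) (hε₁₄ : ε₄ < ε₁) (hε₄ : 0 ≤ ε₄)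
    (hε₂ : ε₂ < 1) (hε₂₅ : ε₅ < ε₂) (hε₅ : 0 ≤ ε₅)
    (hε₃₆ : ε₆ < ε₃) (hε₆ : 0 ≤ ε₆)
    (lam₁ lam₂ : ℝ) (hlam₁ : 1 < lam₁) (hlam₂0 : 0 ≤ lam₂) (hlam₂ : lam₂ < 1)
    (ψ : ℝ → ℝ) (hψpos : ∀ T : ℝ, 0 < T → 0 < ψ T)
    (hψ : Tendsto (fun T : ℝ => ψ T / (Real.log T) ^ 2) atTop (nhds 0))
    (c : ℝ) (hc : 0 < c)
    (hint : ∀ lam a b : ℝ, 1 < lam → R < a → R < b →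
      |∫ x in a..b, Pi x (lam * x)| ≤
        c * ψ (max a b) *
          (lam ^ ε₄ / |lam - 1| ^ ε₁ + lam ^ ε₅ / |lam - lam₁| ^ ε₂ +
            lam ^ ε₆ / |lam - lam₂| ^ ε₃))
    (hbd : ∀ x y : ℝ, R < x → x < y → |Pi x y| ≤ c) :
    Tendsto (fun T : ℝ =>
        ∫ p in {p : ℝ × ℝ | R ≤ p.1 ∧ p.1 ≤ p.2},
          |phi R T p.1 - phi R T p.2| ^ 2 * (Pi p.1 p.2 / (p.2 - p.1)))
      atTop (nhds 0) := by
  set K : ℝ → ℝ := fun lam => lam ^ ε₄ / |lam - 1| ^ ε₁ + lam ^ ε₅ / |lam - lam₁| ^ ε₂ +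
            lam ^ ε₆ / |lam - lam₂| ^ ε₃ with hKdef
  have hK : ∀ lam, 1 < lam → 0 ≤ K lam := by
    intro lam hl
    have : 0 < lam := by linarith
    positivity
  have hW : IntegrableOn (fun lam : ℝ => K lam * auxw (1 + R) lam) (Set.Ioi 1) :=
    aux_W (by linarith) hε₁ hε₁₄ hε₄ hε₂ hε₂₅ hε₅ hε₃₆ hε₆ hlam₁ hlam₂
  set C := ∫ lam in Set.Ioi (1 : ℝ), K lam * auxw (1 + R) lam with hC
  have hC0 : 0 ≤ C := setIntegral_nonneg measurableSet_Ioi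
    fun lam hl => mul_nonneg (hK lam hl) (aux_w_nonneg hl)
  rw [Metric.tendsto_atTop]
  intro ε hε
  obtain ⟨T0, hT0R, hT0⟩ := aux_unif (δ := ε / (2 * (C + 1))) hR hc hmeas hbd hK hψ hint
    (by positivity)
  refine ⟨T0, fun T hT => ?_⟩
  have hRT : R < T := hT0R.trans_le hT
  have hL : 0 < Real.log (T - R + 1) := Real.log_pos (by linarith)
  rw [dist_zero_right]
  have hphi := aux_phi_meas R T
  have hG : Measurable (fun p : ℝ × ℝ =>
      |phi R T p.1 - phi R T p.2| ^ 2 * (Pi p.1 p.2 / (p.2 - p.1))) := by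
    have h1 : Measurable (fun p : ℝ × ℝ => phi R T p.1) := hphi.comp measurable_fst
    have h2 : Measurable (fun p : ℝ × ℝ => phi R T p.2) := hphi.comp measurable_snd
    have h3 : Measurable (fun p : ℝ × ℝ => |phi R T p.1 - phi R T p.2|) := (h1.sub h2).abs
    exact (h3.pow_const 2).mul (hmeas.div (measurable_snd.sub measurable_fst))
  by_cases hI : IntegrableOn (fun p : ℝ × ℝ =>
      |phi R T p.1 - phi R T p.2| ^ 2 * (Pi p.1 p.2 / (p.2 - p.1)))
      {p : ℝ × ℝ | R ≤ p.1 ∧ p.1 ≤ p.2}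
  swap
  · rw [integral_undef hI]; simpa using hε
  rw [aux_cv hR hG hI]
  have hbound : ‖∫ lam in Set.Ioi (1 : ℝ), ∫ x in Set.Ioi R,
      x * (|phi R T x - phi R T (lam * x)| ^ 2 * (Pi x (lam * x) / (lam * x - x)))‖ ≤
      ∫ lam in Set.Ioi (1 : ℝ), ε / (2 * (C + 1)) * (K lam * auxw (1 + R) lam) := by
    refine norm_integral_le_of_norm_le (hW.const_mul _) ?_
    filter_upwards [ae_restrict_mem measurableSet_Ioi] with lam hl
    have hl : 1 < lam := hl
    have hl0 : 0 < lam - 1 := by linarith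
    have hKl := hK lam hl
    have e1 : ∫ x in Set.Ioi R,
        x * (|phi R T x - phi R T (lam * x)| ^ 2 * (Pi x (lam * x) / (lam * x - x))) =
        (lam - 1)⁻¹ * ∫ x in Set.Ioc R T, auxg R T lam x * Pi x (lam * x) := by
      rw [← integral_const_mul]
      rw [← setIntegral_eq_of_subset_of_forall_sdiff_eq_zero measurableSet_Ioi
        (Set.Ioc_subset_Ioi_self : Set.Ioc R T ⊆ Set.Ioi R)]
      · refine setIntegral_congr_fun measurableSet_Ioi fun x hx => ?_
        have hx0 : 0 < x := hR.trans hx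
        have : lam * x - x = (lam - 1) * x := by ring
        simp only [auxg, this]
        field_simp
      · intro x hx
        have hxT : T < x := by
          by_contra h
          exact hx.2 ⟨hx.1, not_lt.mp h⟩
        have := aux_g_zero hR hxT hRT hl
        rw [this]; simp
    have hgm : Measurable (auxg R T lam) := by
      unfold auxg
      have h2 : Measurable (fun x : ℝ => phi R T (lam * x)) :=
        hphi.comp (measurable_const_mul lam)
      exact ((hphi.sub h2).abs).pow_const 2
    have e2 := aux_layer (R := R) (T := T)
      (B := ε / (2 * (C + 1)) * Real.log (T - R + 1) ^ 2 * K lam)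
      (M := (Real.log (1 + (1 + R) * (lam - 1)) / Real.log (T - R + 1)) ^ 2)
      (f := fun x => Pi x (lam * x)) (g := auxg R T lam) (by positivity) (by positivity)
      (hT0 T hT lam hl) (aux_int hR hmeas hbd hl T) hgm (fun x => by unfold auxg; positivity)
      (fun x hx => aux_g_le hR hx hRT hl)
      (fun x y z hx hxz hzy => aux_g_quasi hR hRT hl hx hxz hzy)
    rw [e1, norm_mul, Real.norm_eq_abs, Real.norm_eq_abs, abs_of_pos (inv_pos.mpr hl0)]
    refine (mul_le_mul_of_nonneg_left e2 (inv_pos.mpr hl0).le).trans (le_of_eq ?_)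
    unfold auxw
    field_simp
  refine hbound.trans_lt ?_
  rw [integral_const_mul, ← hC, div_mul_eq_mul_div, div_lt_iff₀ (by positivity)]
  nlinarith
end

section
/- Let 0 < a ≤ b, let α be a nonzero real number, let m > 0 and n ∈ ℝ, and let f : [a,b] → ℝ be continuously differentiable. Then |∫_a^b f(x)·sin(m·x^α + n)·x^{α−1} dx| ≤ (1/(|α|·m))·(2·max_{a ≤ x ≤ b} |f(x)| + ∫_a^b |f′(x)| dx). -/
open MeasureTheory Filter

theorem stmt_5 (a b α m n : ℝ) (ha : 0 < a) (hab : a ≤ b) (hα : α ≠ 0) (hm : 0 < m)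
    (f f' : ℝ → ℝ)
    (hderiv : ∀ x ∈ Set.Icc a b, HasDerivWithinAt f (f' x) (Set.Icc a b) x)
    (hcont : ContinuousOn f' (Set.Icc a b)) :
    |∫ x in a..b, f x * Real.sin (m * x ^ α + n) * x ^ (α - 1)| ≤
      (1 / (|α| * m)) *
        (2 * sSup ((fun x => |f x|) '' Set.Icc a b) + ∫ x in a..b, |f' x|) := by
  have hu : Set.uIcc a b = Set.Icc a b := Set.uIcc_of_le hab
  have hfc : ContinuousOn f (Set.Icc a b) := fun x hx => (hderiv x hx).continuousWithinAt
  set C : ℝ := 1 / (|α| * m) with hC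
  have hC0 : 0 ≤ C := by positivity
  set v : ℝ → ℝ := fun x => -(1 / (α * m)) * Real.cos (m * x ^ α + n) with hv
  have hvd : ∀ x ∈ Set.Icc a b,
      HasDerivAt v (Real.sin (m * x ^ α + n) * x ^ (α - 1)) x := by
    intro x hx
    have hx0 : 0 < x := lt_of_lt_of_le ha hx.1
    have h1 : HasDerivAt (fun y : ℝ => y ^ α) (α * x ^ (α - 1)) x :=
      Real.hasDerivAt_rpow_const (Or.inl hx0.ne')
    have h2 := (((h1.const_mul m).add_const n).cos).const_mul (-(1 / (α * m)))
    refine h2.congr_deriv ?_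
    field_simp
  have hvb : ∀ x, |v x| ≤ C := by
    intro x
    have : |v x| = C * |Real.cos (m * x ^ α + n)| := by
      simp only [hv, hC, abs_mul, abs_neg, abs_div, abs_one, abs_of_pos hm]
    rw [this]
    exact mul_le_of_le_one_right hC0 (Real.abs_cos_le_one _)
  have hvc : ContinuousOn v (Set.Icc a b) := fun x hx => (hvd x hx).continuousAt.continuousWithinAt
  have hpc : ∀ p : ℝ, ContinuousOn (fun x : ℝ => x ^ p) (Set.Icc a b) := fun p x hx =>
    (Real.continuousAt_rpow_const x p (Or.inl (lt_of_lt_of_le ha hx.1).ne')).continuousWithinAt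
  have hv'c : ContinuousOn (fun x => Real.sin (m * x ^ α + n) * x ^ (α - 1)) (Set.Icc a b) :=
    (Real.continuous_sin.comp_continuousOn
      ((continuousOn_const.mul (hpc α)).add continuousOn_const)).mul (hpc _)
  have hibp := intervalIntegral.integral_mul_deriv_eq_deriv_mul_of_hasDerivWithinAt
    (a := a) (b := b) (u := f) (u' := f') (v := v)
    (v' := fun x => Real.sin (m * x ^ α + n) * x ^ (α - 1))
    (by rw [hu]; exact hderiv)
    (by rw [hu]; exact fun x hx => (hvd x hx).hasDerivWithinAt)
    (ContinuousOn.intervalIntegrable (by rwa [hu]))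
    (ContinuousOn.intervalIntegrable (by rwa [hu]))
  simp only [← mul_assoc] at hibp
  rw [hibp]
  have hbdd : BddAbove ((fun x => |f x|) '' Set.Icc a b) :=
    (isCompact_Icc.image_of_continuousOn hfc.abs).bddAbove
  set M := sSup ((fun x => |f x|) '' Set.Icc a b) with hM
  have hle : ∀ x ∈ Set.Icc a b, |f x * v x| ≤ C * M := by
    intro x hx
    have h1 : |f x| ≤ M := le_csSup hbdd ⟨x, hx, rfl⟩
    rw [abs_mul, mul_comm]
    exact mul_le_mul (hvb x) h1 (abs_nonneg _) hC0
  have hint : |∫ x in a..b, f' x * v x| ≤ C * ∫ x in a..b, |f' x| := by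
    rw [← intervalIntegral.integral_const_mul]
    refine (intervalIntegral.abs_integral_le_integral_abs hab).trans ?_
    refine intervalIntegral.integral_mono_on hab
      (ContinuousOn.intervalIntegrable (by rw [hu]; exact (hcont.mul hvc).abs))
      (ContinuousOn.intervalIntegrable (by rw [hu]; exact continuousOn_const.mul hcont.abs)) ?_
    intro x hx
    rw [abs_mul, mul_comm]
    exact mul_le_mul_of_nonneg_right (hvb x) (abs_nonneg _)
  have hA := abs_le.1 (hle a ⟨le_rfl, hab⟩)
  have hB := abs_le.1 (hle b ⟨hab, le_rfl⟩)
  have hI := abs_le.1 hint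
  rw [abs_le]
  constructor <;> linarith [hA.1, hA.2, hB.1, hB.2, hI.1, hI.2]
end

section
/- For every x ∈ ℝ, the function y ↦ S(x−y)² − S′(x−y)·(IS(x−y) − ε(x−y)) is Lebesgue integrable on ℝ and ∫_ℝ [S(x−y)² − S′(x−y)·(IS(x−y) − ε(x−y))] dy = 1. (Equivalently, the truncated second correlation function of the orthogonal sine process integrates to −1: ∫_ℝ ρ^{(2,T)}_{sine,1}(x,y) dy = −ρ^{(1)}_{sine,1}(x) = −1.) -/
open MeasureTheory Filter

/-- The sine kernel `S(x) = sin(πx)/(πx)` (with `S(0) = 1`). -/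
noncomputable def S (t : ℝ) : ℝ :=
  if t = 0 then 1 else Real.sin (Real.pi * t) / (Real.pi * t)

/-- `IS(x) = ∫_0^x S(t) dt`. -/
noncomputable def IS (x : ℝ) : ℝ := ∫ t in (0:ℝ)..x, S t

lemma inner_int (s T : ℝ) :
    ∫ t in (0:ℝ)..T, Real.sin t * Real.exp (-t * s) =
      (1 + s^2)⁻¹ - Real.exp (-T * s) * (Real.cos T + s * Real.sin T) * (1 + s^2)⁻¹ := by
  have h1 : (1 + s^2) ≠ 0 := by positivity
  have := intervalIntegral.integral_eq_sub_of_hasDerivAt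
    (f := fun t => - (Real.exp (-t * s) * (Real.cos t + s * Real.sin t) * (1 + s^2)⁻¹))
    (f' := fun t => Real.sin t * Real.exp (-t * s)) (a := 0) (b := T) ?_ ?_
  · rw [this]; simp; ring
  · intro t _
    have he : HasDerivAt (fun t : ℝ => Real.exp (-t * s)) (Real.exp (-t * s) * (-1 * s)) t :=
      (((hasDerivAt_id t).neg).mul_const s).exp
    have hc := (Real.hasDerivAt_cos t).add ((Real.hasDerivAt_sin t).const_mul s)
    refine (((he.mul hc).mul_const ((1 + s^2)⁻¹)).neg).congr_deriv ?_
    simp only [Pi.add_apply]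
    field_simp
    ring
  · apply Continuous.intervalIntegrable; fun_prop

lemma trig_bd (s T : ℝ) : |(Real.cos T + s * Real.sin T) * (1 + s^2)⁻¹| ≤ 1 := by
  rw [abs_mul, abs_of_pos (a := (1 + s^2)⁻¹) (by positivity), ← div_eq_mul_inv,
    div_le_one (by positivity)]
  apply abs_le_of_sq_le_sq _ (by positivity)
  nlinarith [Real.sin_sq_add_cos_sq T, sq_nonneg (s * Real.cos T - Real.sin T), sq_nonneg s,
    sq_nonneg (s^2)]

lemma prod_int (T : ℝ) :
    Integrable (Function.uncurry fun t s : ℝ => Real.sin t * Real.exp (-t * s))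
      ((volume.restrict (Set.Ioc 0 T)).prod (volume.restrict (Set.Ioi 0))) := by
  rw [integrable_prod_iff]
  · constructor
    · filter_upwards [ae_restrict_mem measurableSet_Ioc] with t ht
      exact (integrableOn_exp_mul_Ioi (a := -t) (by linarith [ht.1]) 0).const_mul (Real.sin t)
    · have : IntegrableOn (fun t => |Real.sinc t|) (Set.Ioc 0 T) :=
        (Real.continuous_sinc.abs).integrableOn_Ioc
      refine this.congr ?_
      filter_upwards [ae_restrict_mem measurableSet_Ioc] with t ht
      simp only [Function.uncurry, norm_mul, Real.norm_eq_abs, Real.abs_exp]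
      rw [integral_const_mul, integral_exp_mul_Ioi (by linarith [ht.1]),
        Real.sinc_of_ne_zero ht.1.ne', abs_div, abs_of_pos ht.1]
      simp [div_eq_mul_inv]
  · apply Continuous.aestronglyMeasurable
    simp only [Function.uncurry_def]
    fun_prop

lemma SI_bd {T : ℝ} (hT : 0 < T) :
    |(∫ t in (0:ℝ)..T, Real.sinc t) - Real.pi / 2| ≤ 1 / T := by
  have key : (∫ t in (0:ℝ)..T, Real.sinc t) =
      ∫ s in Set.Ioi (0:ℝ), ∫ t in (0:ℝ)..T, Real.sin t * Real.exp (-t * s) := by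
    simp_rw [intervalIntegral.integral_of_le hT.le]
    rw [← integral_integral_swap (prod_int T)]
    refine setIntegral_congr_fun measurableSet_Ioc fun t ht => ?_
    rw [integral_const_mul, integral_exp_mul_Ioi (by linarith [ht.1]),
        Real.sinc_of_ne_zero ht.1.ne']
    simp [div_eq_mul_inv]
  simp_rw [inner_int] at key
  have hE := integrableOn_exp_mul_Ioi (a := -T) (by linarith) 0
  have hb : ∀ s : ℝ, ‖Real.exp (-T * s) * (Real.cos T + s * Real.sin T) * (1 + s^2)⁻¹‖
      ≤ Real.exp (-T * s) := by
    intro s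
    rw [mul_assoc, norm_mul, Real.norm_eq_abs, Real.abs_exp, Real.norm_eq_abs]
    exact mul_le_of_le_one_right (Real.exp_pos _).le (trig_bd s T)
  have hI : IntegrableOn (fun s : ℝ => Real.exp (-T * s) * (Real.cos T + s * Real.sin T)
      * (1 + s^2)⁻¹) (Set.Ioi 0) := by
    refine Integrable.mono' hE ?_ (ae_of_all _ hb)
    exact Measurable.aestronglyMeasurable (by fun_prop)
  rw [integral_sub integrable_inv_one_add_sq.integrableOn hI, integral_Ioi_inv_one_add_sq] at key
  rw [key]
  simp only [Real.arctan_zero, sub_zero, sub_sub_cancel_left, abs_neg]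
  refine (norm_integral_le_of_norm_le hE (ae_of_all _ hb)).trans ?_
  rw [integral_exp_mul_Ioi (by linarith)]
  simp

lemma S_eq (t : ℝ) : S t = Real.sinc (Real.pi * t) := by
  simp [S, Real.sinc, Real.pi_ne_zero]

lemma S_cont : Continuous S := by
  rw [funext S_eq]
  exact Real.continuous_sinc.comp (by fun_prop)

lemma S_neg (t : ℝ) : S (-t) = S t := by
  simp [S_eq]

lemma S_abs_le (t : ℝ) : |S t| ≤ 1 := by
  rw [S_eq]; exact Real.abs_sinc_le_one _

lemma IS_eq (x : ℝ) : IS x = (∫ t in (0:ℝ)..Real.pi * x, Real.sinc t) / Real.pi := by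
  simp only [IS, S_eq]
  rw [intervalIntegral.integral_comp_mul_left (fun t => Real.sinc t) Real.pi_ne_zero]
  simp [div_eq_inv_mul]

lemma IS_neg (x : ℝ) : IS (-x) = - IS x := by
  have := intervalIntegral.integral_comp_neg (a := 0) (b := x) (fun t => S t)
  simp only [S_neg, neg_zero] at this
  rw [IS, IS, this, intervalIntegral.integral_symm]

lemma IS_deriv (x : ℝ) : HasDerivAt IS (S x) x :=
  intervalIntegral.integral_hasDerivAt_right (S_cont.intervalIntegrable _ _)
    (S_cont.stronglyMeasurableAtFilter _ _) S_cont.continuousAt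

lemma IS_bd {x : ℝ} (hx : 0 < x) : |IS x - 1/2| * x ≤ 1 := by
  have h := SI_bd (T := Real.pi * x) (by positivity)
  have hpi := Real.pi_gt_three
  have e : IS x - 1/2 = ((∫ t in (0:ℝ)..Real.pi * x, Real.sinc t) - Real.pi/2) / Real.pi := by
    rw [IS_eq]; field_simp
  rw [e, abs_div, abs_of_pos Real.pi_pos]
  calc _ ≤ (1 / (Real.pi * x)) / Real.pi * x := by gcongr
    _ = 1 / (Real.pi * Real.pi) := by field_simp
    _ ≤ 1 := by rw [div_le_one (by positivity)]; nlinarith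

lemma IS_bd2 {x : ℝ} (hx : 0 < x) : |IS x - 1/2| ≤ 2 := by
  rcases le_total x 1 with h | h
  · have h1 : |IS x| ≤ x := by
      have := intervalIntegral.norm_integral_le_of_norm_le_const (a := 0) (b := x) (f := S)
        (C := 1) (fun t _ => S_abs_le t)
      simpa [IS, abs_of_pos hx] using this
    rw [abs_le] at *; constructor <;> linarith
  · have := IS_bd hx
    nlinarith [abs_nonneg (IS x - 1/2)]

lemma S_hasDeriv {u : ℝ} (hu : 0 < u) : HasDerivAt S ((Real.cos (Real.pi * u) - S u) / u) u := by
  have hp := Real.pi_ne_zero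
  have h1 : HasDerivAt (fun t : ℝ => Real.pi * t) Real.pi u := by
    simpa using (hasDerivAt_id u).const_mul Real.pi
  have h2 := h1.sin.div h1 (by positivity)
  have h3 : S =ᶠ[nhds u] (fun t => Real.sin (Real.pi * t)) / (fun t => Real.pi * t) := by
    filter_upwards [lt_mem_nhds hu] with t ht
    simp [S, ht.ne']
  refine (h2.congr_of_eventuallyEq h3).congr_deriv ?_
  simp only [S, hu.ne', if_false]
  field_simp

lemma S_bd {u : ℝ} (hu : 0 < u) : |S u| * u ≤ 1 := by
  simp only [S, hu.ne', if_false]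
  have := Real.pi_gt_three
  rw [abs_div, abs_of_pos (a := Real.pi * u) (by positivity)]
  calc _ ≤ 1 / (Real.pi * u) * u := by gcongr; exact Real.abs_sin_le_one _
    _ = 1 / Real.pi := by field_simp
    _ ≤ 1 := by rw [div_le_one (by positivity)]; linarith

lemma dS_bd {u : ℝ} (hu : 0 < u) : |deriv S u| * u ≤ 2 := by
  rw [(S_hasDeriv hu).deriv, abs_div, abs_of_pos hu, div_mul_cancel₀ _ hu.ne']
  have := abs_sub (Real.cos (Real.pi * u)) (S u)
  linarith [S_abs_le u, Real.abs_cos_le_one (Real.pi * u)]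

lemma dS_bd2 {u : ℝ} (hu : 0 < u) : |deriv S u| ≤ 8 := by
  rcases le_total u 1 with h | h
  · rw [(S_hasDeriv hu).deriv, abs_div, abs_of_pos hu, div_le_iff₀ hu]
    have hx : 0 < Real.pi * u := by positivity
    have h1 := Real.one_sub_sq_div_two_le_cos (x := Real.pi * u)
    have h2 := Real.sin_gt_sub_cube hx
    have h3 : 1 - (Real.pi * u)^2 / 6 ≤ S u := by
      simp only [S, hu.ne', if_false]
      rw [le_div_iff₀ hx]; nlinarith
    have h4 := Real.cos_le_one (Real.pi * u)
    have h5 := (abs_le.1 (S_abs_le u)).2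
    have h6 : (Real.pi * u)^2 ≤ 16 * u := by
      have := Real.pi_le_four
      have : Real.pi^2 ≤ 16 := by nlinarith [Real.pi_pos]
      calc _ = Real.pi^2 * (u * u) := by ring
        _ ≤ 16 * (u * 1) := by gcongr
        _ = _ := by ring
    rw [abs_le]; constructor <;> nlinarith
  · have := dS_bd hu
    nlinarith [abs_nonneg (deriv S u)]

lemma dS_neg (u : ℝ) : deriv S (-u) = - deriv S u := by
  have := deriv_comp_neg S u
  simp only [S_neg] at this
  change deriv S u = _ at this
  linarith

lemma dS_zero : deriv S 0 = 0 := by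
  have := dS_neg 0
  simp only [neg_zero] at this
  linarith

/-- The integrand on the positive half line. -/
noncomputable def GG (u : ℝ) : ℝ := S u ^ 2 - deriv S u * (IS u - 1/2)

lemma F_eq (u : ℝ) : S u ^ 2 - deriv S u * (IS u - (1/2) * Real.sign u) = GG |u| := by
  unfold GG
  rcases lt_trichotomy u 0 with h | h | h
  · rw [Real.sign_of_neg h, abs_of_neg h, S_neg, dS_neg, IS_neg]; ring
  · simp [h, dS_zero]
  · rw [Real.sign_of_pos h, abs_of_pos h]; ring

lemma GG_meas : Measurable GG := by
  have h1 : Measurable S := S_cont.measurable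
  have h2 : Measurable IS :=
    (continuous_iff_continuousAt.2 fun x => (IS_deriv x).continuousAt).measurable
  have h3 := measurable_deriv S
  unfold GG
  fun_prop

lemma GG_bd {u : ℝ} (hu : 0 ≤ u) : |GG u| ≤ 20 * (1 + u^2)⁻¹ := by
  rcases hu.eq_or_lt with h | h
  · rw [← h]; simp [GG, dS_zero, S]
  have a1 : |GG u| ≤ |S u|^2 + |deriv S u| * |IS u - 1/2| := by
    rw [← abs_pow, ← abs_mul]; exact abs_sub _ _
  have b1 := S_abs_le u
  have b2 := dS_bd2 h
  have b3 := IS_bd2 h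
  have c1 := S_bd h
  have c2 := dS_bd h
  have c3 := IS_bd h
  have d1 : |S u|^2 ≤ 1 := by nlinarith [abs_nonneg (S u)]
  have d2 : |deriv S u| * |IS u - 1/2| ≤ 8 * 2 := by gcongr
  have d3 : (|S u| * u)^2 ≤ 1 := pow_le_one₀ (by positivity) c1
  have d4 : (|deriv S u| * u) * (|IS u - 1/2| * u) ≤ 2 * 1 := by gcongr
  rw [← div_eq_mul_inv, le_div_iff₀ (by positivity)]
  calc _ ≤ (|S u|^2 + |deriv S u| * |IS u - 1/2|) * (1 + u^2) := by gcongr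
    _ = |S u|^2 + |deriv S u| * |IS u - 1/2| + (|S u| * u)^2
        + (|deriv S u| * u) * (|IS u - 1/2| * u) := by ring
    _ ≤ 20 := by linarith

lemma GG_int : Integrable (fun u => GG |u|) := by
  refine Integrable.mono' (integrable_inv_one_add_sq.const_mul 20)
    (GG_meas.comp measurable_id.abs).aestronglyMeasurable (ae_of_all _ fun u => ?_)
  have := GG_bd (abs_nonneg u)
  rwa [sq_abs] at this

lemma GG_intOn : IntegrableOn GG (Set.Ioi 0) := by
  refine (GG_int.integrableOn (s := Set.Ioi 0)).congr_fun (fun u hu => ?_) measurableSet_Ioi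
  simp only [abs_of_pos (Set.mem_Ioi.1 hu)]

lemma tendsto_of_bd {f : ℝ → ℝ} {c : ℝ} (h : ∀ u > 0, |f u - c| * u ≤ 1) :
    Tendsto f atTop (nhds c) := by
  rw [tendsto_iff_norm_sub_tendsto_zero]
  refine squeeze_zero' (Eventually.of_forall fun _ => norm_nonneg _) ?_ tendsto_inv_atTop_zero
  filter_upwards [eventually_gt_atTop 0] with u hu
  rw [Real.norm_eq_abs, ← one_div, le_div_iff₀ hu]
  exact h u hu

lemma S_two {u : ℝ} (hu : 0 < u) : S (2 * u) = S u * Real.cos (Real.pi * u) := by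
  have hp := Real.pi_ne_zero
  simp only [S, hu.ne', if_false, mul_eq_zero, two_ne_zero, or_self]
  rw [show Real.pi * (2 * u) = 2 * (Real.pi * u) by ring, Real.sin_two_mul]
  field_simp

lemma GG_integral : ∫ u in Set.Ioi (0:ℝ), GG u = 1/2 := by
  have hIS : Continuous IS := continuous_iff_continuousAt.2 fun x => (IS_deriv x).continuousAt
  have hS := S_cont
  have tI : Tendsto IS atTop (nhds (1/2)) := tendsto_of_bd fun u hu => IS_bd hu
  have tS : Tendsto S atTop (nhds 0) := tendsto_of_bd fun u hu => by simpa using S_bd hu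
  have tU : Tendsto (fun u => u * S u ^ 2) atTop (nhds 0) := tendsto_of_bd fun u hu => by
    rw [sub_zero, abs_of_nonneg (by positivity)]
    calc u * S u ^ 2 * u = (|S u| * u)^2 := by rw [mul_pow, sq_abs]; ring
      _ ≤ 1 := pow_le_one₀ (by positivity) (S_bd hu)
  have t2 : Tendsto (fun u => IS (2 * u)) atTop (nhds (1/2)) :=
    tI.comp (tendsto_id.const_mul_atTop two_pos)
  rw [integral_Ioi_of_hasDerivAt_of_tendsto
    (f := fun u => 2 * IS (2 * u) - 2 * (u * S u ^ 2) - S u * (IS u - 1/2))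
    (m := 2 * (1/2) - 2 * 0 - 0 * (1/2 - 1/2)) ?_ ?_ GG_intOn ?_]
  · simp [IS, S]; norm_num
  · exact Continuous.continuousWithinAt (by fun_prop)
  · intro u hu
    have hu : 0 < u := hu
    have dS := (S_hasDeriv hu).differentiableAt.hasDerivAt
    have e := (S_hasDeriv hu).deriv
    have h2 : HasDerivAt (fun u : ℝ => IS (2 * u)) (S (2 * u) * 2) u := by
      have hm : HasDerivAt (fun t : ℝ => 2 * t) 2 u := by
        simpa using (hasDerivAt_id u).const_mul 2
      exact (IS_deriv (2 * u)).comp u hm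
    have h3 := (hasDerivAt_id u).mul (dS.pow 2)
    have h4 := dS.mul ((IS_deriv u).sub_const (1/2))
    refine (((h2.const_mul 2).sub (h3.const_mul 2)).sub h4).congr_deriv ?_
    simp only [GG, S_two hu, id, Pi.pow_apply]
    have e2 : Real.cos (Real.pi * u) = deriv S u * u + S u := by rw [e]; field_simp; ring
    rw [e2]
    push_cast
    ring
  · exact ((t2.const_mul 2).sub (tU.const_mul 2)).sub (tS.mul (tI.sub_const _))

theorem stmt_14 (x : ℝ) :
    Integrable (fun y : ℝ =>
      S (x - y) ^ 2 - deriv S (x - y) * (IS (x - y) - (1/2) * Real.sign (x - y))) ∧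
    (∫ y : ℝ,
      (S (x - y) ^ 2 - deriv S (x - y) * (IS (x - y) - (1/2) * Real.sign (x - y)))) = 1 := by
  simp_rw [F_eq]
  refine ⟨GG_int.comp_sub_left x, ?_⟩
  rw [integral_sub_left_eq_self (fun u => GG |u|) volume x, integral_comp_abs, GG_integral]
  norm_num
end
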